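/- Let k ≥ 1 and let g : V(Ψ_{k,m,√m/2}) → V(T) be a non-contractive embedding of the unit-weighted tree Ψ_{k,m,√m/2} into a metric tree T of pathwidth at most k. Then for all m of the form m = (2a)^{2^k} with a ∈ ℕ, the average stretch over edges satisfies (1/|E(Ψ_{k,m,√m/2})|) · Σ_{{u,v} ∈ E(Ψ_{k,m,√m/2})} d_T(g(u), g(v)) ≥ m^{2^{−k}} / (2^{8+2k} · k). -/

import Mathlib

open scoped BigOperators

/-- A path decomposition of `G` with `t` bags. -/
def IsPathDecomp {V : Type*} (G : SimpleGraph V) (t : ℕ) (X : Fin t → Finset V) : Prop :=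
  (∀ v : V, ∃ i, v ∈ X i) ∧
  (∀ ⦃u v : V⦄, G.Adj u v → ∃ i, u ∈ X i ∧ v ∈ X i) ∧
  (∀ (v : V) (i j l : Fin t), i ≤ j → j ≤ l → v ∈ X i → v ∈ X l → v ∈ X j)

/-- The pathwidth of `G` is at most `k`. -/
def pathwidthLE {V : Type*} (G : SimpleGraph V) (k : ℕ) : Prop :=
  ∃ (t : ℕ) (X : Fin t → Finset V), IsPathDecomp G t X ∧ ∀ i, (X i).card ≤ k + 1

/-- The pathwidth of `G`. -/
noncomputable def pathwidth {V : Type*} (G : SimpleGraph V) : ℕ :=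
  sInf {k | pathwidthLE G k}
/-- Shortest-path (pseudo)metric of the metric graph `(G, len)`. -/
noncomputable def spDist {V : Type*} (G : SimpleGraph V) (len : Sym2 V → ℝ) (u v : V) : ℝ :=
  sInf (Set.range fun w : G.Walk u v => (w.edges.map len).sum)
/-- `sc m = ⌈√m⌉`. -/
noncomputable def sc (m : ℝ) : ℕ := ⌈Real.sqrt m⌉₊

/-- Non-root vertices of the tree `Ψ_{i,m,l}` with `l` top-level legs: `Ψ_{i,m}` consists of a
copy of the spider `Φ_{⌈√m⌉}` (a root with `⌈√m⌉` legs, each a path with `⌈√m⌉` edges) with a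
copy of `Ψ_{i-1,√m}` rooted at each of its leaves.  `Sum.inl (j, p)` is the `p`-th vertex on
the `j`-th leg; `Sum.inr (j, c)` is a non-root vertex of the copy of `Ψ_{i-1,√m}` hanging at
the leaf of leg `j`. -/
noncomputable def PsiC : ℕ → ℝ → ℕ → Type
  | 0, _, _ => Empty
  | (i + 1), m, l =>
      (Fin l × Fin (sc m)) ⊕ (Fin l × PsiC i (Real.sqrt m) (sc (Real.sqrt m)))

/-- The adjacency relation of the tree `Ψ_{i,m,l}`; `none` is the root. -/
noncomputable def PsiRel : (i : ℕ) → (m : ℝ) → (l : ℕ) →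
    Option (PsiC i m l) → Option (PsiC i m l) → Prop
  | 0, _, _, _, _ => False
  | (i + 1), m, l, x, y =>
      match x, y with
      | none, some (Sum.inl (_, p)) => (p : ℕ) = 0
      | some (Sum.inl (j, p)), some (Sum.inl (j', p')) =>
          j = j' ∧ (p : ℕ) + 1 = (p' : ℕ)
      | some (Sum.inl (j, p)), some (Sum.inr (j', c)) =>
          j = j' ∧ (p : ℕ) + 1 = sc m ∧
            PsiRel i (Real.sqrt m) (sc (Real.sqrt m)) none (some c)
      | some (Sum.inr (j, c)), some (Sum.inr (j', c')) =>
          j = j' ∧ PsiRel i (Real.sqrt m) (sc (Real.sqrt m)) (some c) (some c')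
      | _, _ => False

/-- The unit-weighted tree `Ψ_{i,m,l}` (`Ψ_{i,m} = PsiGraph i m (sc m)`, and
`Ψ_{i,m,ℓ} = PsiGraph i m ⌈ℓ⌉` keeps only `⌈ℓ⌉` of the root's legs). -/
noncomputable def PsiGraph (i : ℕ) (m : ℝ) (l : ℕ) : SimpleGraph (Option (PsiC i m l)) :=
  SimpleGraph.fromRel (PsiRel i m l)
noncomputable instance PsiC.instFintype : ∀ (i : ℕ) (m : ℝ) (l : ℕ), Fintype (PsiC i m l)
  | 0, _, _ => inferInstanceAs (Fintype Empty)
  | (i + 1), m, l =>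
      haveI := PsiC.instFintype i (Real.sqrt m) (sc (Real.sqrt m))
      inferInstanceAs
        (Fintype ((Fin l × Fin (sc m)) ⊕ (Fin l × PsiC i (Real.sqrt m) (sc (Real.sqrt m)))))
open scoped Classical in
/-- Sum of (a symmetric function) `f` over the edges of `G`: each unordered edge is counted
once. -/
noncomputable def edgeSum {V : Type*} [Fintype V] (G : SimpleGraph V) (f : V → V → ℝ) : ℝ :=
  (∑ u, ∑ v, if G.Adj u v then f u v else 0) / 2

open scoped Classical in
/-- The number of edges of `G`, as a real number. -/
noncomputable def numEdges {V : Type*} [Fintype V] (G : SimpleGraph V) : ℝ :=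
  (∑ u, ∑ v, if G.Adj u v then (1 : ℝ) else 0) / 2

section ShortestPathMetric

variable {W : Type*} {T : SimpleGraph W} {len : Sym2 W → ℝ}

theorem walkLength_nonneg (hlen : ∀ e, 0 ≤ len e) {u v : W} (w : T.Walk u v) :
    0 ≤ (w.edges.map len).sum :=
  List.sum_nonneg (by simpa using fun e _ => hlen e)

theorem spDist_le_walk (hlen : ∀ e, 0 ≤ len e) {u v : W} (w : T.Walk u v) :
    spDist T len u v ≤ (w.edges.map len).sum :=
  csInf_le ⟨0, by rintro _ ⟨w, rfl⟩; exact walkLength_nonneg hlen w⟩ ⟨w, rfl⟩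

theorem spDist_nonneg (hlen : ∀ e, 0 ≤ len e) (u v : W) : 0 ≤ spDist T len u v :=
  Real.sInf_nonneg (by rintro _ ⟨w, rfl⟩; exact walkLength_nonneg hlen w)

theorem le_spDist (hT : T.Connected) {u v : W} {r : ℝ}
    (h : ∀ w : T.Walk u v, r ≤ (w.edges.map len).sum) : r ≤ spDist T len u v := by
  obtain ⟨w⟩ := hT.preconnected u v
  exact le_csInf ⟨_, w, rfl⟩ (by rintro _ ⟨w, rfl⟩; exact h w)

theorem spDist_self (hlen : ∀ e, 0 ≤ len e) (u : W) : spDist T len u u = 0 :=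
  le_antisymm (by simpa using spDist_le_walk hlen (SimpleGraph.Walk.nil : T.Walk u u))
    (spDist_nonneg hlen u u)

theorem spDist_comm (hT : T.Connected) (hlen : ∀ e, 0 ≤ len e) (u v : W) :
    spDist T len u v = spDist T len v u := by
  have key : ∀ u v, spDist T len u v ≤ spDist T len v u := fun u v =>
    le_spDist hT fun w => by
      simpa [List.sum_reverse] using spDist_le_walk hlen w.reverse
  exact le_antisymm (key u v) (key v u)

theorem spDist_triangle (hT : T.Connected) (hlen : ∀ e, 0 ≤ len e) (u v x : W) :
    spDist T len u x ≤ spDist T len u v + spDist T len v x := by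
  rw [← sub_le_iff_le_add]
  refine le_spDist hT fun w₁ => ?_
  rw [sub_le_comm]
  refine le_spDist hT fun w₂ => ?_
  have := spDist_le_walk hlen (w₁.append w₂)
  simp only [SimpleGraph.Walk.edges_append, List.map_append, List.sum_append] at this
  linarith

/-- The vertices met by every walk from `u` to `v`; in a tree, the path from `u` to `v`. -/
def separators (T : SimpleGraph W) (u v : W) : Set W := {p | ∀ w : T.Walk u v, p ∈ w.support}

theorem left_mem_separators (u v : W) : u ∈ separators T u v := fun w => w.start_mem_support

theorem right_mem_separators (u v : W) : v ∈ separators T u v := fun w => w.end_mem_support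

theorem separators_subset_union (u r v : W) :
    separators T u v ⊆ separators T u r ∪ separators T r v := by
  intro p hp
  by_contra h
  simp only [separators, Set.mem_union, Set.mem_ofPred_eq, not_or, not_forall] at h
  obtain ⟨⟨w₁, h₁⟩, w₂, h₂⟩ := h
  have := hp (w₁.append w₂)
  rw [SimpleGraph.Walk.mem_support_append_iff] at this
  tauto

theorem separators_comm (u v : W) : separators T u v = separators T v u := by
  ext p
  constructor <;> intro h w <;> simpa using h w.reverse

theorem spDist_add_le_of_mem_separators (hT : T.Connected) (hlen : ∀ e, 0 ≤ len e) {u v p : W}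
    (hp : p ∈ separators T u v) :
    spDist T len u p + spDist T len p v ≤ spDist T len u v := by
  classical
  refine le_spDist hT fun w => ?_
  have h₁ := spDist_le_walk hlen (w.takeUntil p (hp w))
  have h₂ := spDist_le_walk hlen (w.dropUntil p (hp w))
  have h₃ := congrArg (fun w => (w.edges.map len).sum) (w.take_spec (hp w))
  simp only [SimpleGraph.Walk.edges_append, List.map_append, List.sum_append] at h₃
  linarith

theorem mem_separators_of_mem_support (hT : T.IsAcyclic) {u v p : W} {w : T.Walk u v}
    (hw : w.IsPath) (hp : p ∈ w.support) : p ∈ separators T u v := by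
  classical
  intro w'
  have h : (⟨w, hw⟩ : T.Path u v) = w'.toPath := (hT.subsingleton_path u v).elim _ _
  have h' : w = w'.bypass := congrArg Subtype.val h
  exact w'.support_bypass_subset_support (h' ▸ hp)

theorem mem_separators_total (hT : T.IsAcyclic) {u v p q : W} {w : T.Walk u v}
    (hw : w.IsPath) (hp : p ∈ w.support) (hq : q ∈ w.support) :
    p ∈ separators T u q ∨ q ∈ separators T u p := by
  classical
  have hp' := hp
  rw [← w.take_spec hq, SimpleGraph.Walk.mem_support_append_iff] at hp'
  rcases hp' with h | h
  · exact .inl (mem_separators_of_mem_support hT (hw.takeUntil hq) h)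
  · right
    have hw' := hw
    rw [← w.take_spec hq, ← (w.dropUntil q hq).take_spec h,
      SimpleGraph.Walk.append_assoc] at hw'
    refine mem_separators_of_mem_support hT hw'.of_append_left ?_
    rw [SimpleGraph.Walk.mem_support_append_iff]
    simp

/-- The distance to the start of a path in a metric tree is `1`-Lipschitz, and an isometry on the
path. -/
theorem spDist_le_abs_sub_of_mem_path (hT : T.IsTree) (hlen : ∀ e, 0 ≤ len e) {u v p q : W}
    {w : T.Walk u v} (hw : w.IsPath) (hp : p ∈ w.support) (hq : q ∈ w.support) :
    spDist T len p q ≤ |spDist T len u p - spDist T len u q| := by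
  rcases mem_separators_total hT.isAcyclic hw hp hq with h | h
  · have := spDist_add_le_of_mem_separators hT.connected hlen h
    rw [abs_sub_comm]
    exact (by linarith : _ ≤ _).trans (le_abs_self _)
  · have := spDist_add_le_of_mem_separators hT.connected hlen h
    rw [spDist_comm hT.connected hlen]
    exact (by linarith : _ ≤ _).trans (le_abs_self _)

theorem abs_spDist_sub_le (hT : T.Connected) (hlen : ∀ e, 0 ≤ len e) (u p q : W) :
    |spDist T len u p - spDist T len u q| ≤ spDist T len p q := by
  have h₁ := spDist_triangle hT hlen u p q
  have h₂ := spDist_triangle hT hlen u q p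
  rw [spDist_comm hT hlen q p] at h₂
  rw [abs_le]
  constructor <;> linarith

/-- `S` contains the path between any two of its vertices. -/
def SeparatorConvex (T : SimpleGraph W) (S : Set W) : Prop :=
  ∀ ⦃u v : W⦄, u ∈ S → v ∈ S → separators T u v ⊆ S

/-- The part of `S` that can be reached from `r` without meeting `P`. -/
def avoiding (T : SimpleGraph W) (S P : Set W) (r : W) : Set W :=
  {x | x ∈ S ∧ Disjoint (separators T r x) P}

theorem SeparatorConvex.avoiding {S : Set W} (hS : SeparatorConvex T S) (P : Set W) (r : W) :
    SeparatorConvex T (avoiding T S P r) := by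
  intro u v hu hv p hp
  refine ⟨hS hu.1 hv.1 hp, ?_⟩
  have hu' := hu.2
  have hv' := hv.2
  rw [Set.disjoint_left] at hu' hv' ⊢
  intro q hq hqP
  rcases separators_subset_union u r v hp with h | h
  · by_contra
    rw [separators_comm] at h
    refine hu' (fun w => ?_) hqP
    classical
    have h₁ := hq (w.takeUntil p (h w))
    exact w.support_takeUntil_subset_support _ h₁
  · refine hv' (fun w => ?_) hqP
    classical
    have h₁ := hq (w.takeUntil p (h w))
    exact w.support_takeUntil_subset_support _ h₁

theorem disjoint_of_mem_avoiding {S P : Set W} {r x : W} (hx : x ∈ avoiding T S P r) : x ∉ P :=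
  fun h => Set.disjoint_left.1 hx.2 (right_mem_separators r x) h

theorem IsPathDecomp.exists_mem_support_mem_bag {t : ℕ} {X : Fin t → Finset W}
    (hX : IsPathDecomp T t X) {u v : W} (w : T.Walk u v) {i j l : Fin t} (hij : i ≤ j)
    (hjl : j ≤ l) (hu : u ∈ X i) (hv : v ∈ X l) : ∃ p ∈ w.support, p ∈ X j := by
  induction w generalizing i with
  | nil => exact ⟨_, by simp, hX.2.2 _ i j l hij hjl hu hv⟩
  | @cons u x v h w ih =>
    obtain ⟨c, huc, hxc⟩ := hX.2.1 h
    rcases le_total c j with hc | hc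
    · obtain ⟨p, hp, hpj⟩ := ih hc hxc hv
      exact ⟨p, by simp [hp], hpj⟩
    · exact ⟨u, by simp, hX.2.2 u i j c hij hc hu huc⟩

open scoped Classical in
/-- A convex set of vertices of a tree contains a path whose removal lowers the number of its
vertices in every bag of a path decomposition. -/
theorem IsPathDecomp.exists_path {t : ℕ} {X : Fin t → Finset W}
    (hX : IsPathDecomp T t X) (hT : T.IsTree) {S : Set W} (hS : SeparatorConvex T S)
    (hne : S.Nonempty) {k : ℕ} (hk : ∀ s, ((X s).filter (· ∈ S)).card ≤ k + 1) :
    ∃ (u v : W) (w : T.Walk u v), w.IsPath ∧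
      ∀ r s, ((X s).filter (· ∈ avoiding T S {p | p ∈ w.support} r)).card ≤ k := by
  set I : Finset (Fin t) := Finset.univ.filter fun s => ∃ v ∈ X s, v ∈ S with hI
  have hIne : I.Nonempty := by
    obtain ⟨v, hv⟩ := hne
    obtain ⟨i, hi⟩ := hX.1 v
    exact ⟨i, by simpa [hI] using ⟨v, hi, hv⟩⟩
  obtain ⟨u, hu, huS⟩ := (Finset.mem_filter.1 (I.min'_mem hIne)).2
  obtain ⟨v, hv, hvS⟩ := (Finset.mem_filter.1 (I.max'_mem hIne)).2
  obtain ⟨w₀⟩ := hT.connected.preconnected u v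
  refine ⟨u, v, w₀.bypass, w₀.bypass_isPath, fun r s => ?_⟩
  by_cases hs : s ∈ I
  · obtain ⟨p, hp, hps⟩ := hX.exists_mem_support_mem_bag w₀.bypass (I.min'_le s hs)
      (I.le_max' s hs) hu hv
    refine Nat.le_of_lt_succ ((Finset.card_lt_card ?_).trans_le (hk s))
    refine (Finset.ssubset_iff_of_subset ?_).2 ⟨p, ?_, ?_⟩
    · exact Finset.monotone_filter_right _ fun x _ hx => hx.1
    · exact Finset.mem_filter.2 ⟨hps, hS huS hvS
        (mem_separators_of_mem_support hT.isAcyclic w₀.bypass_isPath hp)⟩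
    · exact fun h => disjoint_of_mem_avoiding (Finset.mem_filter.1 h).2 hp
  · rw [Finset.filter_eq_empty_iff.2, Finset.card_empty]
    · exact Nat.zero_le _
    · exact fun x hx h => hs (by simpa [hI] using ⟨x, hx, h.1⟩)

open scoped Classical in
theorem SeparatorConvex.subsingleton {t : ℕ} {X : Fin t → Finset W}
    (hX : IsPathDecomp T t X) (hT : T.IsTree) {S : Set W} (hS : SeparatorConvex T S)
    (hk : ∀ s, ((X s).filter (· ∈ S)).card ≤ 1) : S.Subsingleton := by
  intro u hu v hv
  by_contra huv
  obtain ⟨w₀⟩ := hT.connected.preconnected u v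
  have hw := w₀.bypass_isPath
  generalize w₀.bypass = w at hw
  cases w with
  | nil => exact huv rfl
  | @cons _ x _ h w =>
    obtain ⟨c, huc, hxc⟩ := hX.2.1 h
    have hx : x ∈ S :=
      hS hu hv (mem_separators_of_mem_support hT.isAcyclic hw (by simp))
    exact h.ne (Finset.card_le_one.1 (hk c) u (by simp [huc, hu]) x (by simp [hxc, hx]))

end ShortestPathMetric

namespace PsiC

/-- The last vertex of the `j`-th leg. -/
noncomputable def last {i : ℕ} {m : ℝ} {l : ℕ} (j : Fin l) : Option (PsiC (i + 1) m l) :=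
  if h : 0 < sc m then some (Sum.inl (j, ⟨sc m - 1, by omega⟩)) else none

/-- The inclusion of the copy of `Ψ_{i,√m}` hanging at the end of the `j`-th leg. -/
noncomputable def incl {i : ℕ} {m : ℝ} {l : ℕ} (j : Fin l) :
    Option (PsiC i (Real.sqrt m) (sc (Real.sqrt m))) → Option (PsiC (i + 1) m l)
  | none => last j
  | some c => some (Sum.inr (j, c))

/-- The parent of a non-root vertex. -/
noncomputable def par : (i : ℕ) → (m : ℝ) → (l : ℕ) → PsiC i m l → Option (PsiC i m l)
  | 0, _, _, _ => none
  | (i + 1), m, l, c =>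
      match c with
      | Sum.inl (j, p) =>
          if (p : ℕ) = 0 then none
          else some (Sum.inl (j, ⟨p - 1, lt_of_le_of_lt (Nat.sub_le _ _) p.isLt⟩))
      | Sum.inr (j, c) => incl j (par i (Real.sqrt m) (sc (Real.sqrt m)) c)

/-- The vertices of one branch of `Ψ_{i+1,m,l}`: a leg and what hangs at its end. -/
abbrev Branch (i : ℕ) (m : ℝ) : Type :=
  Fin (sc m) ⊕ PsiC i (Real.sqrt m) (sc (Real.sqrt m))

/-- A vertex of the `j`-th branch as a vertex of the tree. -/
noncomputable def vtx {i : ℕ} {m : ℝ} {l : ℕ} (j : Fin l) : Branch i m → PsiC (i + 1) m l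
  | Sum.inl p => Sum.inl (j, p)
  | Sum.inr c => Sum.inr (j, c)

variable {i : ℕ} {m : ℝ} {l : ℕ}

theorem par_inr (j : Fin l) (c : PsiC i (Real.sqrt m) (sc (Real.sqrt m))) :
    par (i + 1) m l (vtx j (Sum.inr c)) = incl j (par i _ _ c) := rfl

theorem par_inl_zero (j : Fin l) (p : Fin (sc m)) (hp : (p : ℕ) = 0) :
    par (i + 1) m l (vtx j (Sum.inl p)) = none := if_pos hp

theorem par_inl_succ (j : Fin l) (p : ℕ) (hp : p + 1 < sc m) :
    par (i + 1) m l (vtx j (Sum.inl ⟨p + 1, hp⟩)) =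
      some (vtx j (Sum.inl ⟨p, by omega⟩)) :=
  if_neg (t := (none : Option (PsiC (i + 1) m l))) (Nat.succ_ne_zero p)

theorem incl_none (j : Fin l) (h : 0 < sc m) :
    (incl j none : Option (PsiC (i + 1) m l)) =
      some (vtx j (Sum.inl ⟨sc m - 1, by omega⟩)) := dif_pos h

theorem incl_some (j : Fin l) (c : PsiC i (Real.sqrt m) (sc (Real.sqrt m))) :
    (incl j (some c) : Option (PsiC (i + 1) m l)) = some (vtx j (Sum.inr c)) := rfl

theorem exists_vtx (c : PsiC (i + 1) m l) : ∃ j x, c = vtx j x := by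
  match c with
  | Sum.inl (j, p) => exact ⟨j, Sum.inl p, rfl⟩
  | Sum.inr (j, c) => exact ⟨j, Sum.inr c, rfl⟩

/-- The non-root vertices of `Ψ_{i+1,m,l}`, sorted by branches. -/
noncomputable def equivBranch (i : ℕ) (m : ℝ) (l : ℕ) : PsiC (i + 1) m l ≃ Fin l × Branch i m where
  toFun c := match c with
    | Sum.inl (j, p) => (j, Sum.inl p)
    | Sum.inr (j, c) => (j, Sum.inr c)
  invFun x := vtx x.1 x.2
  left_inv c := match c with
    | Sum.inl (_, _) => rfl
    | Sum.inr (_, _) => rfl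
  right_inv x := match x with
    | (_, Sum.inl _) => rfl
    | (_, Sum.inr _) => rfl

theorem sum_eq_sum_vtx (f : PsiC (i + 1) m l → ℝ) : ∑ c, f c = ∑ j, ∑ x, f (vtx j x) := by
  rw [← Fintype.sum_prod_type', ← (equivBranch i m l).symm.sum_comp]
  rfl

theorem sc_pos (hm : 1 ≤ m) : 0 < sc m := Nat.ceil_pos.2 (Real.sqrt_pos.2 (by linarith))

/-- Induction along the tree, restricted to the `j`-th branch. -/
theorem branch_induction_aux
    (ih : ∀ Q : Option (PsiC i (Real.sqrt m) (sc (Real.sqrt m))) → Prop, Q none →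
      (∀ c, Q (par i _ _ c) → Q (some c)) → ∀ y, Q y)
    (hm : 1 ≤ m) (j : Fin l) (Q : Option (PsiC (i + 1) m l) → Prop) (h0 : Q none)
    (hs : ∀ x : Branch i m, Q (par (i + 1) m l (vtx j x)) → Q (some (vtx j x)))
    (x : Branch i m) : Q (some (vtx j x)) := by
  have hleg : ∀ p : ℕ, ∀ hp : p < sc m, Q (some (vtx j (Sum.inl ⟨p, hp⟩))) := by
    intro p
    induction p with
    | zero => exact fun hp => hs _ (by rwa [par_inl_zero _ _ rfl])
    | succ p hrec => exact fun hp => hs _ (by rw [par_inl_succ]; exact hrec _)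
  rcases x with p | c
  · exact hleg p p.isLt
  · refine ih (fun y => Q (incl j y)) ?_ ?_ (some c)
    · rw [incl_none j (sc_pos hm)]
      exact hleg _ _
    · exact fun c hc => hs (Sum.inr c) hc

theorem tree_induction (i : ℕ) : ∀ {m : ℝ} {l : ℕ} (_ : 1 ≤ m)
    (Q : Option (PsiC i m l) → Prop) (_ : Q none)
    (_ : ∀ c, Q (par i m l c) → Q (some c)) (y : Option (PsiC i m l)), Q y := by
  induction i with
  | zero =>
    intro m l _ Q h0 _ y
    match y with
    | none => exact h0
    | some c => exact c.elim
  | succ i ih =>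
    intro m l hm Q h0 hs y
    match y with
    | none => exact h0
    | some c =>
      obtain ⟨j, x, rfl⟩ := exists_vtx c
      exact branch_induction_aux (ih (Real.one_le_sqrt.2 hm)) hm j Q h0 (fun x => hs _) x

theorem branch_induction (hm : 1 ≤ m) (j : Fin l) (Q : Option (PsiC (i + 1) m l) → Prop)
    (h0 : Q none) (hs : ∀ x : Branch i m, Q (par (i + 1) m l (vtx j x)) → Q (some (vtx j x)))
    (x : Branch i m) : Q (some (vtx j x)) :=
  branch_induction_aux (tree_induction i (Real.one_le_sqrt.2 hm)) hm j Q h0 hs x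

theorem psiRel_iff (i : ℕ) : ∀ {m : ℝ} {l : ℕ} (_ : 1 ≤ m) (u v : Option (PsiC i m l)),
    PsiRel i m l u v ↔ ∃ c, v = some c ∧ u = par i m l c := by
  induction i with
  | zero => exact fun _ u v => ⟨False.elim, fun ⟨c, _⟩ => c.elim⟩
  | succ i ih =>
    intro m l hm u v
    have hpos := sc_pos hm
    have ih' := @ih _ (sc (Real.sqrt m)) (Real.one_le_sqrt.2 hm)
    match u, v with
    | u, none =>
      constructor
      · intro h
        rcases u with _ | (_ | _) <;> exact h.elim
      · rintro ⟨c, hc, -⟩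
        simp at hc
    | none, some (Sum.inl (j, p)) =>
      constructor
      · exact fun h => ⟨vtx j (Sum.inl p), rfl, (par_inl_zero j p h).symm⟩
      · rintro ⟨c, hc, hu⟩
        obtain rfl := Option.some.inj hc
        by_contra h
        obtain ⟨p, hp⟩ := p
        obtain ⟨p, rfl⟩ := Nat.exists_eq_succ_of_ne_zero h
        exact absurd (hu.trans (par_inl_succ j p hp)) (by simp)
    | none, some (Sum.inr (j, c)) =>
      refine ⟨False.elim, ?_⟩
      rintro ⟨c, hc, hu⟩
      obtain rfl := Option.some.inj hc
      replace hu := hu.trans (par_inr j c)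
      cases hpar : par i _ _ c with
      | none => rw [hpar, incl_none j hpos] at hu; simp at hu
      | some c' => rw [hpar, incl_some] at hu; simp at hu
    | some (Sum.inl (j, p)), some (Sum.inl (j', p')) =>
      constructor
      · rintro ⟨rfl, h⟩
        obtain ⟨p', hp'⟩ := p'
        obtain ⟨p, hp⟩ := p
        obtain rfl : p + 1 = p' := h
        exact ⟨vtx j (Sum.inl ⟨p + 1, hp'⟩), rfl, (par_inl_succ j p hp').symm⟩
      · rintro ⟨c, hc, hu⟩
        obtain rfl := Option.some.inj hc
        obtain ⟨p', hp'⟩ := p'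
        rcases p' with _ | p'
        · exact absurd (hu.trans (par_inl_zero j' _ rfl)) (by simp)
        · have h : (Sum.inl (j, p) : (Fin l × Fin (sc m)) ⊕
              (Fin l × PsiC i (Real.sqrt m) (sc (Real.sqrt m)))) = Sum.inl (j', ⟨p', by omega⟩) :=
            Option.some.inj (hu.trans (par_inl_succ j' p' hp'))
          simp only [Sum.inl.injEq, Prod.mk.injEq] at h
          obtain ⟨rfl, rfl⟩ := h
          exact ⟨rfl, rfl⟩
    | some (Sum.inl (j, p)), some (Sum.inr (j', c)) =>
      constructor
      · rintro ⟨rfl, h, hr⟩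
        obtain ⟨c', hc', hr⟩ := (ih' _ _).1 hr
        obtain rfl := Option.some.inj hc'
        refine ⟨vtx j (Sum.inr c), rfl, ?_⟩
        rw [par_inr, ← hr, incl_none j hpos]
        obtain ⟨p, hp⟩ := p
        obtain rfl : p = sc m - 1 := by simp only at h; omega
        rfl
      · rintro ⟨c', hc, hu⟩
        obtain rfl := Option.some.inj hc
        replace hu := hu.trans (par_inr j' c)
        cases hpar : par i _ _ c with
        | none =>
          rw [hpar, incl_none j' hpos] at hu
          have h : (Sum.inl (j, p) : (Fin l × Fin (sc m)) ⊕
              (Fin l × PsiC i (Real.sqrt m) (sc (Real.sqrt m)))) =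
                Sum.inl (j', ⟨sc m - 1, by omega⟩) := Option.some.inj hu
          simp only [Sum.inl.injEq, Prod.mk.injEq] at h
          obtain ⟨rfl, rfl⟩ := h
          exact ⟨rfl, Nat.sub_add_cancel hpos, (ih' _ _).2 ⟨c, rfl, hpar.symm⟩⟩
        | some c' =>
          rw [hpar, incl_some] at hu
          exact absurd (Option.some.inj hu) Sum.inl_ne_inr
    | some (Sum.inr (j, c)), some (Sum.inl (j', p)) =>
      refine ⟨False.elim, ?_⟩
      rintro ⟨c', hc, hu⟩
      obtain rfl := Option.some.inj hc
      obtain ⟨p, hp⟩ := p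
      rcases p with _ | p
      · exact absurd (hu.trans (par_inl_zero j' _ rfl)) (by simp)
      · exact absurd (Option.some.inj (hu.trans (par_inl_succ j' p hp))) Sum.inr_ne_inl
    | some (Sum.inr (j, c)), some (Sum.inr (j', c')) =>
      constructor
      · rintro ⟨rfl, h⟩
        obtain ⟨c₀, hc₀, hr⟩ := (ih' _ _).1 h
        obtain rfl := Option.some.inj hc₀
        refine ⟨vtx j (Sum.inr c'), rfl, ?_⟩
        rw [par_inr, ← hr, incl_some]
        rfl
      · rintro ⟨c₀, hc, hu⟩
        obtain rfl := Option.some.inj hc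
        replace hu := hu.trans (par_inr j' c')
        cases hpar : par i _ _ c' with
        | none =>
          rw [hpar, incl_none j' hpos] at hu
          exact absurd (Option.some.inj hu) Sum.inr_ne_inl
        | some c₁ =>
          rw [hpar, incl_some] at hu
          have h : (Sum.inr (j, c) : (Fin l × Fin (sc m)) ⊕
              (Fin l × PsiC i (Real.sqrt m) (sc (Real.sqrt m)))) =
                Sum.inr (j', c₁) := Option.some.inj hu
          simp only [Sum.inr.injEq, Prod.mk.injEq] at h
          obtain ⟨rfl, rfl⟩ := h
          exact ⟨rfl, (ih' _ _).2 ⟨c', rfl, hpar.symm⟩⟩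

/-- Every `1`-Lipschitz function on the tree is dominated by `d` pulled back along `g`. -/
def NonContractive {W : Type*} (d : W → W → ℝ) (g : Option (PsiC i m l) → W) : Prop :=
  ∀ F : Option (PsiC i m l) → ℝ, (∀ c, |F (some c) - F (par i m l c)| ≤ 1) →
    ∀ u v, F u - F v ≤ d (g u) (g v)

/-- The function on the tree with value `z` at the root and given by `f` on the branches. -/
noncomputable def ofBranches {α : Type*} (z : α) (f : Fin l → Branch i m → α) :
    Option (PsiC (i + 1) m l) → α
  | none => z
  | some c => f (equivBranch i m l c).1 (equivBranch i m l c).2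

theorem ofBranches_vtx {α : Type*} (z : α) (f : Fin l → Branch i m → α) (j : Fin l)
    (x : Branch i m) : ofBranches z f (some (vtx j x)) = f j x := by
  rcases x with p | c <;> rfl

theorem ofBranches_none {α : Type*} (z : α) (f : Fin l → Branch i m → α) :
    ofBranches z f none = z := rfl

/-- Case distinction on the edges of `Ψ_{i+1,m,l}`. -/
theorem edge_cases (R : Option (PsiC (i + 1) m l) → Option (PsiC (i + 1) m l) → Prop)
    (h₁ : ∀ j (h : 0 < sc m), R none (some (vtx j (Sum.inl ⟨0, h⟩))))
    (h₂ : ∀ j p (h : p + 1 < sc m),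
      R (some (vtx j (Sum.inl ⟨p, by omega⟩))) (some (vtx j (Sum.inl ⟨p + 1, h⟩))))
    (h₃ : ∀ j c, R (incl j (par i _ _ c)) (incl j (some c))) (c : PsiC (i + 1) m l) :
    R (par (i + 1) m l c) (some c) := by
  obtain ⟨j, ⟨_ | p, hp⟩ | c, rfl⟩ := exists_vtx c
  · rw [par_inl_zero _ _ rfl]; exact h₁ j hp
  · rw [par_inl_succ]; exact h₂ j p hp
  · rw [par_inr]; exact h₃ j c

theorem exists_depth (i : ℕ) : ∀ {m : ℝ} {l : ℕ} (_ : 1 ≤ m),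
    ∃ F : Option (PsiC i m l) → ℝ, F none = 0 ∧ ∀ c, F (some c) = F (par i m l c) + 1 := by
  induction i with
  | zero => exact fun _ => ⟨fun _ => 0, rfl, fun c => c.elim⟩
  | succ i ih =>
    intro m l hm
    obtain ⟨F, h0, hF⟩ := ih (m := Real.sqrt m) (l := sc (Real.sqrt m)) (Real.one_le_sqrt.2 hm)
    obtain ⟨G, hG0, hGv⟩ : ∃ G : Option (PsiC (i + 1) m l) → ℝ, G none = 0 ∧ ∀ j x,
        G (some (vtx j x)) =
          Sum.elim (fun p : Fin (sc m) => ((p : ℕ) : ℝ) + 1) (fun c => sc m + F (some c)) x :=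
      ⟨ofBranches 0 fun _ => _, rfl, ofBranches_vtx 0 _⟩
    have hG : ∀ j y, G (incl j y) = sc m + F y := by
      intro j y
      match y with
      | none =>
        rw [incl_none j (sc_pos hm), hGv, h0]
        simp only [Sum.elim_inl]
        rw [Nat.cast_sub (sc_pos hm)]
        simp
      | some c => rw [incl_some, hGv]; rfl
    refine ⟨G, hG0, edge_cases (fun u v => G v = G u + 1) ?_ ?_ ?_⟩
    · intro j h
      rw [hGv, hG0]
      simp
    · intro j p h
      rw [hGv, hGv]
      simp
    · intro j c
      rw [hG, hG, hF]
      ring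

theorem adj_iff (hm : 1 ≤ m) (u v : Option (PsiC i m l)) :
    (PsiGraph i m l).Adj u v ↔ PsiRel i m l u v ∨ PsiRel i m l v u := by
  rw [PsiGraph, SimpleGraph.fromRel_adj, and_iff_right_iff_imp]
  obtain ⟨F, -, hF⟩ := exists_depth i (l := l) hm
  rintro h rfl
  obtain ⟨c, rfl, hc⟩ := (psiRel_iff i hm _ _).1 (h.elim id id)
  have := hF c
  rw [← hc] at this
  linarith

theorem not_psiRel_and (hm : 1 ≤ m) (u v : Option (PsiC i m l)) :
    ¬ (PsiRel i m l u v ∧ PsiRel i m l v u) := by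
  obtain ⟨F, -, hF⟩ := exists_depth i (l := l) hm
  rintro ⟨h, h'⟩
  obtain ⟨c, rfl, hc⟩ := (psiRel_iff i hm _ _).1 h
  obtain ⟨c', rfl, hc'⟩ := (psiRel_iff i hm _ _).1 h'
  have h₁ := hF c
  have h₂ := hF c'
  rw [← hc] at h₁
  rw [← hc'] at h₂
  linarith

open scoped Classical in
theorem sum_adj (hm : 1 ≤ m) (f : Option (PsiC i m l) → Option (PsiC i m l) → ℝ)
    (hf : ∀ u v, f u v = f v u) :
    (∑ u, ∑ v, if (PsiGraph i m l).Adj u v then f u v else 0) =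
      2 * ∑ c, f (par i m l c) (some c) := by
  have h₁ : ∀ u v, (if (PsiGraph i m l).Adj u v then f u v else 0) =
      (if PsiRel i m l u v then f u v else 0) + (if PsiRel i m l v u then f v u else 0) := by
    intro u v
    have := not_psiRel_and hm u v
    rw [adj_iff hm, hf v u]
    by_cases h : PsiRel i m l u v <;> by_cases h' : PsiRel i m l v u <;> simp_all
  have h₂ : (∑ v, ∑ u, if PsiRel i m l u v then f u v else 0) =
      ∑ c, f (par i m l c) (some c) := by
    rw [Fintype.sum_option, Finset.sum_eq_zero, zero_add]
    · refine Finset.sum_congr rfl fun c _ => ?_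
      rw [Finset.sum_eq_single (par i m l c), if_pos]
      · exact (psiRel_iff i hm _ _).2 ⟨c, rfl, rfl⟩
      · intro u _ hu
        refine if_neg fun h => hu ?_
        obtain ⟨c', hc, hu⟩ := (psiRel_iff i hm _ _).1 h
        rw [hu, Option.some.inj hc]
      · simp
    · intro u _
      refine if_neg fun h => ?_
      obtain ⟨c', hc, hu⟩ := (psiRel_iff i hm _ _).1 h
      simp at hc
  simp only [h₁, Finset.sum_add_distrib]
  rw [h₂, Finset.sum_comm, h₂, two_mul]

theorem edgeSum_eq (hm : 1 ≤ m) (f : Option (PsiC i m l) → Option (PsiC i m l) → ℝ)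
    (hf : ∀ u v, f u v = f v u) :
    edgeSum (PsiGraph i m l) f = ∑ c, f (par i m l c) (some c) := by
  rw [edgeSum, sum_adj hm f hf, mul_div_cancel_left₀ _ two_ne_zero]

theorem numEdges_eq (hm : 1 ≤ m) : numEdges (PsiGraph i m l) = Fintype.card (PsiC i m l) := by
  rw [numEdges, sum_adj hm (fun _ _ => 1) fun _ _ => rfl, mul_div_cancel_left₀ _ two_ne_zero]
  simp

theorem card_succ : Fintype.card (PsiC (i + 1) m l) =
    l * (sc m + Fintype.card (PsiC i (Real.sqrt m) (sc (Real.sqrt m)))) := by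
  rw [Fintype.card_congr (equivBranch i m l)]
  simp

/-- A map that expands graph distances is non-contractive. -/
theorem NonContractive.of_dist_le (hm : 1 ≤ m) {W : Type*} {d : W → W → ℝ}
    {g : Option (PsiC i m l) → W}
    (hg : ∀ u v, ((PsiGraph i m l).dist u v : ℝ) ≤ d (g u) (g v)) : NonContractive d g := by
  intro F hF u v
  refine le_trans ?_ (hg u v)
  have hroot : ∀ y, (PsiGraph i m l).Reachable none y := by
    refine tree_induction i hm _ .rfl fun c hc => hc.trans (SimpleGraph.Adj.reachable ?_)
    exact (adj_iff hm _ _).2 (.inl ((psiRel_iff i hm _ _).2 ⟨c, rfl, rfl⟩))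
  obtain ⟨w, hw⟩ := ((hroot u).symm.trans (hroot v)).exists_walk_length_eq_dist
  rw [← hw]
  clear hw
  induction w with
  | nil => simp
  | @cons u x v h w ih =>
    have hux : F u - F x ≤ 1 := by
      rcases (adj_iff hm _ _).1 h with h | h
      · obtain ⟨c, rfl, rfl⟩ := (psiRel_iff i hm _ _).1 h
        have := (abs_le.1 (hF c)).1
        linarith
      · obtain ⟨c, rfl, rfl⟩ := (psiRel_iff i hm _ _).1 h
        exact (abs_le.1 (hF c)).2
    rw [SimpleGraph.Walk.length_cons]
    push_cast
    linarith

theorem NonContractive.comp_incl (hm : 1 ≤ m) {W : Type*} {d : W → W → ℝ}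
    {g : Option (PsiC (i + 1) m l) → W} (hg : NonContractive d g) (j : Fin l) :
    NonContractive d (g ∘ incl j) := by
  intro F hF u v
  obtain ⟨G, hG0, hGv⟩ : ∃ G : Option (PsiC (i + 1) m l) → ℝ, G none = F none ∧ ∀ j' x,
      G (some (vtx j' x)) =
        Sum.elim (fun _ => F none) (fun c => if j' = j then F (some c) else F none) x :=
    ⟨ofBranches (F none) fun j' => _, rfl, ofBranches_vtx _ _⟩
  have hG : ∀ j' y, G (incl j' y) = if j' = j then F y else F none := by
    intro j' y
    match y with
    | none => rw [incl_none j' (sc_pos hm), hGv]; simp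
    | some c => rw [incl_some, hGv]; rfl
  have := hg G (edge_cases (fun u v => |G v - G u| ≤ 1) ?_ ?_ ?_) (incl j u) (incl j v)
  · simpa [hG] using this
  · intro j h
    rw [hGv, hG0]
    simp
  · intro j p h
    rw [hGv, hGv]
    simp
  · intro j' c
    rw [hG, hG]
    split_ifs
    · exact hF c
    · simp

theorem NonContractive.one_le (hm : 1 ≤ m) {W : Type*} {d : W → W → ℝ}
    {g : Option (PsiC i m l) → W} (hg : NonContractive d g) (c : PsiC i m l) :
    1 ≤ d (g (some c)) (g (par i m l c)) := by
  obtain ⟨F, -, hF⟩ := exists_depth i (l := l) hm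
  have := hg F (fun c => by simp [hF]) (some c) (par i m l c)
  rw [hF] at this
  linarith

/-- The depth of a vertex of a branch, truncated at the length of the leg. -/
noncomputable def legDepth : Branch i m → ℝ := Sum.elim (fun p => (p : ℕ) + 1) (fun _ => sc m)

theorem NonContractive.weighted_legDepth_sub_le (hm : 1 ≤ m) {W : Type*} {d : W → W → ℝ}
    {g : Option (PsiC (i + 1) m l) → W} (hg : NonContractive d g) (s : Fin l → ℝ)
    (hs : ∀ j, |s j| ≤ 1) (u v : Option (PsiC (i + 1) m l)) :
    ofBranches 0 (fun j x => s j * legDepth x) u - ofBranches 0 (fun j x => s j * legDepth x) v ≤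
      d (g u) (g v) := by
  set G : Option (PsiC (i + 1) m l) → ℝ := ofBranches 0 (fun j x => s j * legDepth x) with hGdef
  have hG : ∀ j y, G (incl j y) = s j * sc m := by
    intro j' y
    match y with
    | none =>
      rw [incl_none j' (sc_pos hm), hGdef, ofBranches_vtx, legDepth, Sum.elim_inl]
      simp only
      rw [Nat.cast_sub (sc_pos hm)]
      simp
    | some c => rw [incl_some, hGdef, ofBranches_vtx]; rfl
  refine hg G (edge_cases (fun u v => |G v - G u| ≤ 1) ?_ ?_ ?_) u v
  · intro j h
    rw [hGdef, ofBranches_vtx, ofBranches_none]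
    simpa [legDepth] using hs j
  · intro j p h
    rw [hGdef, ofBranches_vtx, ofBranches_vtx]
    have : s j * legDepth (i := i) (m := m) (Sum.inl ⟨p + 1, h⟩) -
        s j * legDepth (i := i) (m := m) (Sum.inl ⟨p, by omega⟩) = s j := by
      simp [legDepth]
      ring
    rw [this]
    exact hs j
  · intro j' c
    rw [hG, hG]
    simp

theorem NonContractive.legDepth_le (hm : 1 ≤ m) {W : Type*} {d : W → W → ℝ}
    {g : Option (PsiC (i + 1) m l) → W} (hg : NonContractive d g) (j : Fin l) (x : Branch i m) :
    legDepth x ≤ d (g (some (vtx j x))) (g none) := by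
  have := hg.weighted_legDepth_sub_le hm (fun _ => 1) (by simp) (some (vtx j x)) none
  simpa [ofBranches_vtx, ofBranches_none] using this

theorem NonContractive.legDepth_add_le (hm : 1 ≤ m) {W : Type*} {d : W → W → ℝ}
    {g : Option (PsiC (i + 1) m l) → W} (hg : NonContractive d g) {j j' : Fin l} (hj : j ≠ j')
    (x y : Branch i m) :
    legDepth x + legDepth y ≤ d (g (some (vtx j x))) (g (some (vtx j' y))) := by
  have := hg.weighted_legDepth_sub_le hm (fun b => if b = j then 1 else -1)
    (fun b => by split_ifs <;> simp) (some (vtx j x)) (some (vtx j' y))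
  rw [ofBranches_vtx, ofBranches_vtx] at this
  simpa [hj.symm] using this

/-- The total stretch of the edges of the `j`-th branch. -/
noncomputable def branchSum {W : Type*} (d : W → W → ℝ) (g : Option (PsiC (i + 1) m l) → W)
    (j : Fin l) : ℝ :=
  ∑ x : Branch i m, d (g (par (i + 1) m l (vtx j x))) (g (some (vtx j x)))

theorem sum_eq_sum_branchSum {W : Type*} (d : W → W → ℝ) (g : Option (PsiC (i + 1) m l) → W) :
    ∑ c, d (g (par (i + 1) m l c)) (g (some c)) = ∑ j, branchSum d g j :=
  sum_eq_sum_vtx _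

theorem branchSum_eq {W : Type*} (d : W → W → ℝ) (g : Option (PsiC (i + 1) m l) → W)
    (j : Fin l) : branchSum d g j =
      ∑ p, d (g (par (i + 1) m l (vtx j (Sum.inl p)))) (g (some (vtx j (Sum.inl p)))) +
      ∑ c, d ((g ∘ incl j) (par i _ _ c)) ((g ∘ incl j) (some c)) :=
  Fintype.sum_sum_type _

theorem dist_leg_le {W : Type*} {d : W → W → ℝ} (hself : ∀ u, d u u = 0)
    (htri : ∀ u v w, d u w ≤ d u v + d v w) (g : Option (PsiC (i + 1) m l) → W) (j : Fin l)
    (p : ℕ) (hp : p < sc m) :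
    d (g none) (g (par (i + 1) m l (vtx j (Sum.inl ⟨p, hp⟩)))) +
      d (g (par (i + 1) m l (vtx j (Sum.inl ⟨p, hp⟩)))) (g (some (vtx j (Sum.inl ⟨p, hp⟩)))) ≤
    ∑ q ∈ Finset.univ.filter (fun q : Fin (sc m) => (q : ℕ) ≤ p),
      d (g (par (i + 1) m l (vtx j (Sum.inl q)))) (g (some (vtx j (Sum.inl q)))) := by
  induction p with
  | zero =>
    have : Finset.univ.filter (fun q : Fin (sc m) => (q : ℕ) ≤ 0) = {⟨0, hp⟩} := by
      ext q
      simp [Fin.ext_iff]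
    rw [this, Finset.sum_singleton, par_inl_zero _ _ rfl, hself, zero_add]
  | succ p ih =>
    have : Finset.univ.filter (fun q : Fin (sc m) => (q : ℕ) ≤ p + 1) =
        insert ⟨p + 1, hp⟩ (Finset.univ.filter (fun q : Fin (sc m) => (q : ℕ) ≤ p)) := by
      ext q
      simp [Fin.ext_iff]
      omega
    rw [this, Finset.sum_insert (by simp), par_inl_succ, add_comm]
    gcongr
    exact (htri _ _ _).trans (ih _)

/-- The distance from the image of the root to the far end of an edge is at most the total
stretch of the branch containing the edge. -/
theorem dist_le_branchSum_aux {W : Type*} {d : W → W → ℝ} (hself : ∀ u, d u u = 0)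
    (hnn : ∀ u v, 0 ≤ d u v) (htri : ∀ u v w, d u w ≤ d u v + d v w) (hm : 1 ≤ m)
    (ih : ∀ (g : Option (PsiC i (Real.sqrt m) (sc (Real.sqrt m))) → W) c,
      d (g none) (g (par i _ _ c)) + d (g (par i _ _ c)) (g (some c)) ≤
        ∑ c, d (g (par i _ _ c)) (g (some c)))
    (g : Option (PsiC (i + 1) m l) → W) (j : Fin l) (x : Branch i m) :
    d (g none) (g (par (i + 1) m l (vtx j x))) +
      d (g (par (i + 1) m l (vtx j x))) (g (some (vtx j x))) ≤ branchSum d g j := by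
  rw [branchSum_eq]
  have hleg : ∀ p : Fin (sc m), d (g none) (g (par (i + 1) m l (vtx j (Sum.inl p)))) +
      d (g (par (i + 1) m l (vtx j (Sum.inl p)))) (g (some (vtx j (Sum.inl p)))) ≤
      ∑ p, d (g (par (i + 1) m l (vtx j (Sum.inl p)))) (g (some (vtx j (Sum.inl p)))) :=
    fun p => (dist_leg_le hself htri g j p p.isLt).trans
      (Finset.sum_le_sum_of_subset_of_nonneg (Finset.filter_subset _ _) fun _ _ _ => hnn _ _)
  rcases x with p | c
  · exact (hleg p).trans (le_add_of_nonneg_right (Finset.sum_nonneg fun _ _ => hnn _ _))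
  · have h₁ := ih (g ∘ incl j) c
    have h₂ := hleg ⟨sc m - 1, Nat.sub_lt (sc_pos hm) one_pos⟩
    rw [← incl_none j (sc_pos hm)] at h₂
    have h₃ := htri (g none) (g (incl j none)) (g (incl j (par i _ _ c)))
    have h₄ := htri (g none) (g (par (i + 1) m l (vtx j
      (Sum.inl ⟨sc m - 1, Nat.sub_lt (sc_pos hm) one_pos⟩)))) (g (incl j none))
    rw [par_inr, ← incl_some]
    simp only [Function.comp_apply] at h₁ ⊢
    linarith

theorem branchSum_nonneg {W : Type*} {d : W → W → ℝ} (hnn : ∀ u v, 0 ≤ d u v)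
    (g : Option (PsiC (i + 1) m l) → W) (j : Fin l) : 0 ≤ branchSum d g j :=
  Finset.sum_nonneg fun _ _ => hnn _ _

theorem dist_le_sum (i : ℕ) {W : Type*} {d : W → W → ℝ} (hself : ∀ u, d u u = 0)
    (hnn : ∀ u v, 0 ≤ d u v) (htri : ∀ u v w, d u w ≤ d u v + d v w) :
    ∀ {m : ℝ} {l : ℕ} (_ : 1 ≤ m) (g : Option (PsiC i m l) → W) (c : PsiC i m l),
      d (g none) (g (par i m l c)) + d (g (par i m l c)) (g (some c)) ≤
        ∑ c, d (g (par i m l c)) (g (some c)) := by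
  induction i with
  | zero => exact fun _ _ c => c.elim
  | succ i ih =>
    intro m l hm g c
    obtain ⟨j, x, rfl⟩ := exists_vtx c
    rw [sum_eq_sum_branchSum]
    exact (dist_le_branchSum_aux hself hnn htri hm (ih (Real.one_le_sqrt.2 hm)) g j x).trans
      (Finset.single_le_sum (fun j _ => branchSum_nonneg hnn g j) (Finset.mem_univ j))

theorem dist_le_branchSum {W : Type*} {d : W → W → ℝ} (hself : ∀ u, d u u = 0)
    (hnn : ∀ u v, 0 ≤ d u v) (htri : ∀ u v w, d u w ≤ d u v + d v w) (hm : 1 ≤ m)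
    (g : Option (PsiC (i + 1) m l) → W) (j : Fin l) (x : Branch i m) :
    d (g none) (g (par (i + 1) m l (vtx j x))) +
      d (g (par (i + 1) m l (vtx j x))) (g (some (vtx j x))) ≤ branchSum d g j :=
  dist_le_branchSum_aux hself hnn htri hm
    (dist_le_sum i hself hnn htri (Real.one_le_sqrt.2 hm)) g j x

end PsiC

theorem sq_card_div_four_le_sum_natAbs (s : Finset ℤ) :
    (s.card : ℝ) ^ 2 / 4 ≤ ∑ z ∈ s, (|(z : ℝ)| + 1) := by
  induction s using Finset.induction_on_max_value (fun z : ℤ => |z|) with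
  | empty => simp
  | insert z s hz hmax ih =>
    rw [Finset.sum_insert hz, Finset.card_insert_of_notMem hz]
    have h₁ : insert z s ⊆ Finset.Icc (-|z|) |z| := by
      intro y hy
      rw [Finset.mem_Icc, ← abs_le]
      rcases Finset.mem_insert.1 hy with rfl | hy
      · exact le_rfl
      · exact hmax y hy
    have h₂ := Finset.card_le_card h₁
    rw [Finset.card_insert_of_notMem hz, Int.card_Icc] at h₂
    have h₃ : ((s.card : ℤ) + 1) ≤ 2 * |z| + 1 := by
      have := abs_nonneg z
      omega
    have h₄ : ((s.card : ℝ) + 1) ≤ 2 * |(z : ℝ)| + 1 := by exact_mod_cast h₃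
    push_cast
    nlinarith

/-- If `n` reals are pairwise at distance at least `D`, then the sum of their distances to any
point, truncated below at `D`, grows quadratically in `n`. -/
theorem mul_card_sq_le_sum_of_separated {ι : Type*} (L : Finset ι) (x B : ι → ℝ) (r : ℝ) {D : ℝ}
    (hD : 0 < D) (hsep : ∀ i ∈ L, ∀ j ∈ L, i ≠ j → D ≤ |x i - x j|)
    (hB : ∀ j ∈ L, |x j - r| ≤ B j) (hDB : ∀ j ∈ L, D ≤ B j) :
    D * (L.card : ℝ) ^ 2 / 12 ≤ ∑ j ∈ L, B j := by
  classical
  set z : ι → ℤ := fun j => ⌊(x j - r) / D⌋ with hz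
  have hinj : Set.InjOn z L := by
    intro i hi j hj hij
    by_contra hne
    have h := Int.abs_sub_lt_one_of_floor_eq_floor hij
    rw [← sub_div, abs_div, abs_of_pos hD, div_lt_one hD] at h
    have := hsep i hi j hj hne
    rw [sub_sub_sub_cancel_right] at h
    linarith
  have h := sq_card_div_four_le_sum_natAbs (L.image z)
  rw [Finset.card_image_of_injOn hinj, Finset.sum_image hinj] at h
  have hj : ∀ j ∈ L, D / 3 * (|(z j : ℝ)| + 1) ≤ B j := by
    intro j hj
    have h₁ : |(z j : ℝ)| * D ≤ |x j - r| + D := by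
      have h₂ : |(z j : ℝ)| ≤ |(x j - r) / D| + 1 := by
        have h₃ := Int.floor_le ((x j - r) / D)
        have h₄ := Int.lt_floor_add_one ((x j - r) / D)
        have h₅ : |(z j : ℝ) - (x j - r) / D| ≤ 1 := abs_le.2 ⟨by linarith, by linarith⟩
        have h₆ := abs_add_le ((x j - r) / D) ((z j : ℝ) - (x j - r) / D)
        rw [add_sub_cancel] at h₆
        linarith
      rw [abs_div, abs_of_pos hD] at h₂
      calc |(z j : ℝ)| * D ≤ (|x j - r| / D + 1) * D := by gcongr
        _ = |x j - r| + D := by field_simp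
    have := hB j hj
    have := hDB j hj
    linarith
  calc D * (L.card : ℝ) ^ 2 / 12 = D / 3 * ((L.card : ℝ) ^ 2 / 4) := by ring
    _ ≤ D / 3 * ∑ j ∈ L, (|(z j : ℝ)| + 1) := by gcongr
    _ = ∑ j ∈ L, D / 3 * (|(z j : ℝ)| + 1) := Finset.mul_sum _ _ _
    _ ≤ _ := Finset.sum_le_sum hj

/-- Combines the contributions of branches of three kinds: those with total stretch at least
`N * a / C`, those with total stretch at least `a * D / 2`, and those in `L`. -/
theorem le_sum_of_trichotomy {ι : Type*} (J : Finset ι) (B : ι → ℝ) (L : Finset ι) (hL : L ⊆ J)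
    {N a C D : ℝ} (ha : 0 < a) (hN : 0 < N) (hC : 256 ≤ C) (hND : N ≤ 2 * D) (haD : a ≤ D)
    (hJ : N ≤ 2 * J.card) (hB : ∀ j ∈ J, 0 ≤ B j)
    (hrest : ∀ j ∈ J, j ∉ L → N * a / C ≤ B j ∨ a * D / 2 ≤ B j)
    (hsumL : D * (L.card : ℝ) ^ 2 / 12 ≤ ∑ j ∈ L, B j) :
    N ^ 2 * a / (4 * C) ≤ ∑ j ∈ J, B j := by
  classical
  set P := J.filter fun j => N * a / C ≤ B j with hP
  set Q := J.filter fun j => a * D / 2 ≤ B j with hQ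
  have hcard : J.card ≤ P.card + Q.card + L.card := by
    refine (Finset.card_le_card (t := P ∪ Q ∪ L) fun j hj => ?_).trans
      ((Finset.card_union_le _ _).trans (by gcongr; exact Finset.card_union_le _ _))
    simp only [hP, hQ, Finset.mem_union, Finset.mem_filter]
    by_cases h : j ∈ L
    · exact .inr h
    · have := hrest j hj h
      tauto
  have hcard' : (J.card : ℝ) ≤ P.card + Q.card + L.card := by exact_mod_cast hcard
  have hsub : ∀ K ⊆ J, ∑ j ∈ K, B j ≤ ∑ j ∈ J, B j := fun K hK =>
    Finset.sum_le_sum_of_subset_of_nonneg hK fun j hj _ => hB j hj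
  have hC0 : 0 < C := by linarith
  have hD0 : 0 < D := by linarith
  by_cases h₁ : N / 4 ≤ P.card
  · refine le_trans ?_ (hsub P (Finset.filter_subset _ _))
    have h := P.card_nsmul_le_sum B (N * a / C) fun j hj => (Finset.mem_filter.1 hj).2
    rw [nsmul_eq_mul] at h
    calc N ^ 2 * a / (4 * C) = N / 4 * (N * a / C) := by field_simp
      _ ≤ P.card * (N * a / C) := by gcongr
      _ ≤ _ := h
  have hsmall : N ^ 2 * a / (4 * C) ≤ N ^ 2 * a / 1024 := by
    gcongr
    linarith
  refine hsmall.trans ?_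
  by_cases h₂ : N / 8 ≤ Q.card
  · refine le_trans ?_ (hsub Q (Finset.filter_subset _ _))
    have h := Q.card_nsmul_le_sum B (a * D / 2) fun j hj => (Finset.mem_filter.1 hj).2
    rw [nsmul_eq_mul] at h
    calc N ^ 2 * a / 1024 ≤ N / 8 * (a * (N / 2) / 2) := by nlinarith [mul_pos (pow_pos hN 2) ha]
      _ ≤ Q.card * (a * D / 2) := by gcongr; linarith
      _ ≤ _ := h
  · push Not at h₁ h₂
    have h₃ : N / 8 ≤ L.card := by linarith
    refine le_trans ?_ (hsub L hL)
    calc N ^ 2 * a / 1024 ≤ a * (N / 8) ^ 2 / 12 := by nlinarith [mul_pos (pow_pos hN 2) ha]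
      _ ≤ D * (L.card : ℝ) ^ 2 / 12 := by gcongr
      _ ≤ _ := hsumL

theorem mem_avoiding_self {W : Type*} {T : SimpleGraph W} {S P : Set W} {r : W} (hS : r ∈ S)
    (hP : r ∉ P) : r ∈ avoiding T S P r := by
  refine ⟨hS, Set.disjoint_left.2 fun p hp => ?_⟩
  have := hp SimpleGraph.Walk.nil
  rw [SimpleGraph.Walk.support_nil, List.mem_singleton] at this
  rwa [this]

theorem mem_avoiding_of_disjoint {W : Type*} {T : SimpleGraph W} {S P : Set W} {r u v : W}
    (hu : u ∈ avoiding T S P r) (hv : v ∈ S) (huv : Disjoint (separators T u v) P) :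
    v ∈ avoiding T S P r :=
  ⟨hv, Disjoint.mono_left (separators_subset_union r u v) (hu.2.union_left huv)⟩

namespace PsiC

variable {i : ℕ} {m : ℝ} {l : ℕ}

theorem par_vtx_induction (hm : 1 ≤ m) {j : Fin l} {Q : Option (PsiC (i + 1) m l) → Prop}
    (h0 : Q none) (hQ : ∀ x : Branch i m, Q (some (vtx j x))) (x : Branch i m) :
    Q (par (i + 1) m l (vtx j x)) := by
  rcases x with ⟨_ | p, hp⟩ | c
  · rwa [par_inl_zero _ _ rfl]
  · rw [par_inl_succ]
    exact hQ _
  · rw [par_inr]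
    cases par i _ _ c with
    | none => rw [incl_none j (sc_pos hm)]; exact hQ _
    | some c => exact hQ (Sum.inr c)

/-- If the edges of a branch avoid `P`, then the whole branch stays in one component. -/
theorem mem_avoiding_of_branch {W : Type*} {T : SimpleGraph W} {S P : Set W} (hm : 1 ≤ m)
    {g : Option (PsiC (i + 1) m l) → W} {j : Fin l} (h0 : g none ∈ S)
    (hS : ∀ x : Branch i m, g (some (vtx j x)) ∈ S)
    (hP : ∀ x : Branch i m,
      Disjoint (separators T (g (par (i + 1) m l (vtx j x))) (g (some (vtx j x)))) P) :
    g none ∈ avoiding T S P (g none) ∧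
      ∀ x : Branch i m, g (some (vtx j x)) ∈ avoiding T S P (g none) := by
  have h : g none ∈ avoiding T S P (g none) := by
    refine mem_avoiding_self h0 (Set.disjoint_left.1 (hP (Sum.inl ⟨0, sc_pos hm⟩)) ?_)
    rw [par_inl_zero _ _ rfl]
    exact left_mem_separators _ _
  exact ⟨h, branch_induction hm j (fun y => g y ∈ avoiding T S P (g none)) h
    fun x hx => mem_avoiding_of_disjoint hx (hS x) (hP x)⟩

/-- Suppose that each branch either has large total stretch or has an edge of small stretch, far
from the root, that is mapped across a given path. Then the total stretch is large. -/
theorem le_sum_branchSum_of_forall {W : Type*} {T : SimpleGraph W} {len : Sym2 W → ℝ}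
    (hT : T.IsTree) (hlen : ∀ e, 0 ≤ len e) {u v : W} {w : T.Walk u v} (hw : w.IsPath)
    (hm : 1 ≤ m) {g : Option (PsiC (i + 1) m l) → W} (hg : NonContractive (spDist T len) g)
    {J : Finset (Fin l)} {a C D : ℝ} (ha : 0 < a) (hC : 256 ≤ C) (hD : (sc m : ℝ) ≤ 2 * D)
    (haD : a ≤ D) (hJ : sc m ≤ 2 * J.card)
    (hforall : ∀ j ∈ J, sc m * a / C ≤ branchSum (spDist T len) g j ∨
      a * D / 2 ≤ branchSum (spDist T len) g j ∨
      ∃ x : Branch i m, D ≤ legDepth x ∧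
        spDist T len (g (par (i + 1) m l (vtx j x))) (g (some (vtx j x))) < D / 2 ∧
        ∃ p ∈ w.support,
          p ∈ separators T (g (par (i + 1) m l (vtx j x))) (g (some (vtx j x)))) :
    (sc m : ℝ) ^ 2 * a / (4 * C) ≤ ∑ j ∈ J, branchSum (spDist T len) g j := by
  classical
  have hD0 : 0 < D := ha.trans_le haD
  have hnn := spDist_nonneg (T := T) hlen
  have hself := spDist_self (T := T) hlen
  have hcomm := spDist_comm hT.connected hlen
  have htri := spDist_triangle hT.connected hlen
  set L : Finset (Fin l) := J.filter fun j => ∃ x : Branch i m, D ≤ legDepth x ∧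
        spDist T len (g (par (i + 1) m l (vtx j x))) (g (some (vtx j x))) < D / 2 ∧
        ∃ p ∈ w.support,
          p ∈ separators T (g (par (i + 1) m l (vtx j x))) (g (some (vtx j x))) with hL
  refine le_sum_of_trichotomy J _ L (Finset.filter_subset _ _) ha
    (Nat.cast_pos.2 (sc_pos hm)) hC hD haD (by exact_mod_cast hJ)
    (fun j _ => branchSum_nonneg hnn g j) (fun j hj hjL => ?_) ?_
  · rcases hforall j hj with h | h | h
    · exact .inl h
    · exact .inr h
    · exact absurd (Finset.mem_filter.2 ⟨hj, h⟩) hjL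
  · have hex : ∀ j, ∃ (x : Branch i m) (p : W), j ∈ L → D ≤ legDepth x ∧
        spDist T len (g (par (i + 1) m l (vtx j x))) (g (some (vtx j x))) < D / 2 ∧
        p ∈ w.support ∧
          p ∈ separators T (g (par (i + 1) m l (vtx j x))) (g (some (vtx j x))) := by
      intro j
      by_cases hj : j ∈ L
      · obtain ⟨x, h₁, h₂, p, h₃, h₄⟩ := (Finset.mem_filter.1 hj).2
        exact ⟨x, p, fun _ => ⟨h₁, h₂, h₃, h₄⟩⟩
      · exact ⟨Sum.inl ⟨0, sc_pos hm⟩, u, fun h => absurd h hj⟩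
    choose x p hxp using hex
    have hsplit : ∀ j ∈ L, spDist T len (g (par (i + 1) m l (vtx j (x j)))) (p j) +
        spDist T len (p j) (g (some (vtx j (x j)))) ≤
        spDist T len (g (par (i + 1) m l (vtx j (x j)))) (g (some (vtx j (x j)))) :=
      fun j hj => spDist_add_le_of_mem_separators hT.connected hlen (hxp j hj).2.2.2
    refine mul_card_sq_le_sum_of_separated L (fun j => spDist T len u (p j)) _
      (spDist T len u (g none)) hD0 ?_ ?_ ?_
    · intro j hj j' hj' hne
      refine le_trans ?_ (spDist_le_abs_sub_of_mem_path hT hlen hw (hxp j hj).2.2.1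
        (hxp j' hj').2.2.1)
      have h₁ := hg.legDepth_add_le hm hne (x j) (x j')
      have h₂ := htri (g (some (vtx j (x j)))) (p j) (g (some (vtx j' (x j'))))
      have h₃ := htri (p j) (p j') (g (some (vtx j' (x j'))))
      have h₄ := hcomm (g (some (vtx j (x j)))) (p j)
      have := hsplit j hj
      have := hsplit j' hj'
      have := hnn (g (par (i + 1) m l (vtx j (x j)))) (p j)
      have := hnn (g (par (i + 1) m l (vtx j' (x j')))) (p j')
      linarith [(hxp j hj).1, (hxp j' hj').1, (hxp j hj).2.1, (hxp j' hj').2.1]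
    · intro j hj
      refine (abs_spDist_sub_le hT.connected hlen _ _ _).trans ?_
      have h₁ := dist_le_branchSum hself hnn htri hm g j (x j)
      have h₂ := htri (g none) (g (par (i + 1) m l (vtx j (x j)))) (p j)
      have h₃ := hnn (p j) (g (some (vtx j (x j))))
      have := hsplit j hj
      rw [hcomm]
      linarith
    · intro j hj
      have h₁ := dist_le_branchSum hself hnn htri hm g j (x j)
      have h₂ := htri (g none) (g (par (i + 1) m l (vtx j (x j)))) (g (some (vtx j (x j))))
      have h₃ := hg.legDepth_le hm j (x j)
      rw [hcomm] at h₃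
      linarith [(hxp j hj).1]

theorem sqrt_eq_of_eq_pow {a : ℕ} {i : ℕ} (h : m = (2 * (a : ℝ)) ^ 2 ^ (i + 1)) :
    Real.sqrt m = (2 * (a : ℝ)) ^ 2 ^ i := by
  rw [h, pow_succ, pow_mul]
  exact Real.sqrt_sq (by positivity)

theorem cast_sc_of_eq_pow {a : ℕ} {i : ℕ} (h : m = (2 * (a : ℝ)) ^ 2 ^ (i + 1)) :
    (sc m : ℝ) = (2 * (a : ℝ)) ^ 2 ^ i := by
  have h' : Real.sqrt m = (((2 * a) ^ 2 ^ i : ℕ) : ℝ) := by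
    rw [sqrt_eq_of_eq_pow h]
    push_cast
    rfl
  rw [sc, h', Nat.ceil_natCast, ← h', sqrt_eq_of_eq_pow h]

theorem one_le_of_eq_pow {a : ℕ} (ha : 0 < a) {i : ℕ} (h : m = (2 * (a : ℝ)) ^ 2 ^ i) :
    1 ≤ m := by
  have : (1 : ℝ) ≤ a := by exact_mod_cast ha
  rw [h]
  exact one_le_pow₀ (by linarith)

open scoped Classical in
theorem le_sum_branchSum {W : Type*} {T : SimpleGraph W} {len : Sym2 W → ℝ}
    (hT : T.IsTree) (hlen : ∀ e, 0 ≤ len e) {t : ℕ} {X : Fin t → Finset W}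
    (hX : IsPathDecomp T t X) {a : ℕ} (ha : 0 < a) (i : ℕ) :
    ∀ {m : ℝ} {l : ℕ} (_ : m = (2 * (a : ℝ)) ^ 2 ^ (i + 1)) {J : Finset (Fin l)}
      (_ : sc m ≤ 2 * J.card) {g : Option (PsiC (i + 1) m l) → W}
      (_ : NonContractive (spDist T len) g) {S : Set W} (_ : SeparatorConvex T S)
      (_ : g none ∈ S) (_ : ∀ j ∈ J, ∀ x : Branch i m, g (some (vtx j x)) ∈ S)
      (_ : ∀ s, ((X s).filter (· ∈ S)).card ≤ i + 1 + 1),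
      (sc m : ℝ) ^ 2 * a / (4 * 2 ^ (8 + 2 * i)) ≤
        ∑ j ∈ J, branchSum (spDist T len) g j := by
  have ha' : (0 : ℝ) < a := Nat.cast_pos.2 ha
  have ha1 : (1 : ℝ) ≤ a := by exact_mod_cast ha
  have hnn := spDist_nonneg (T := T) hlen
  have h256 : ∀ i : ℕ, (256 : ℝ) ≤ 2 ^ (8 + 2 * i) := fun i => by
    have : (1 : ℝ) ≤ 2 ^ (2 * i) := one_le_pow₀ (by norm_num)
    rw [pow_add]
    norm_num
    linarith
  induction i with
  | zero =>
    intro m l hma J hJ g hg S hS h0 hJS hk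
    have hm := one_le_of_eq_pow ha hma
    have hsc : (sc m : ℝ) = 2 * a := by simpa using cast_sc_of_eq_pow hma
    have hsc' : sc m = 2 * a := by exact_mod_cast hsc
    obtain ⟨u, v, w, hw, hwk⟩ := hX.exists_path hT hS ⟨_, h0⟩ hk
    refine le_sum_branchSum_of_forall hT hlen hw hm hg (D := a) ha' (h256 0) hsc.le le_rfl hJ
      fun j hj => .inr ?_
    by_contra! hcon
    obtain ⟨hlt, hcon⟩ := hcon
    have hlarge : ∀ q : Fin a, (a : ℝ) / 2 ≤
        spDist T len (g (par (0 + 1) m l (vtx j (Sum.inl ⟨a + q, by omega⟩))))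
          (g (some (vtx j (Sum.inl ⟨a + q, by omega⟩)))) := by
      intro q
      by_contra! hq
      have hdisj := hcon (Sum.inl ⟨a + q, by omega⟩)
        (by simp only [legDepth, Sum.elim_inl]; push_cast; linarith [(q : ℕ).cast_nonneg (α := ℝ)])
        hq
      set x : Branch 0 m := Sum.inl ⟨a + q, by omega⟩
      have hpar : g (par (0 + 1) m l (vtx j x)) ∈ S :=
        par_vtx_induction hm (Q := fun y => g y ∈ S) h0 (hJS j hj) x
      have h₁ : g (par (0 + 1) m l (vtx j x)) ∈
          avoiding T S {p | p ∈ w.support} (g (par (0 + 1) m l (vtx j x))) :=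
        mem_avoiding_self hpar fun h => hdisj _ h (left_mem_separators _ _)
      have h₂ := mem_avoiding_of_disjoint h₁ (hJS j hj x)
        (Set.disjoint_right.2 fun p hp => hdisj p hp)
      have h₃ := (hS.avoiding _ _).subsingleton hX hT (hwk _) h₁ h₂
      have h₄ := hg.one_le hm (vtx j x)
      rw [← h₃, spDist_self hlen] at h₄
      linarith
    refine hlt.not_ge ?_
    let emb : Fin a ↪ Branch 0 m :=
      ⟨fun q => Sum.inl ⟨a + q, by omega⟩, fun q q' h => by
        have := Sum.inl_injective h
        simp only [Fin.mk.injEq] at this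
        omega⟩
    calc (a : ℝ) * a / 2 = ∑ _q : Fin a, (a : ℝ) / 2 := by simp; ring
      _ ≤ ∑ q : Fin a, spDist T len (g (par (0 + 1) m l (vtx j (emb q))))
          (g (some (vtx j (emb q)))) := Finset.sum_le_sum fun q _ => hlarge q
      _ = ∑ x ∈ Finset.univ.map emb, spDist T len (g (par (0 + 1) m l (vtx j x)))
          (g (some (vtx j x))) := by rw [Finset.sum_map]
      _ ≤ branchSum (spDist T len) g j :=
        Finset.sum_le_sum_of_subset_of_nonneg (Finset.subset_univ _) fun _ _ _ => hnn _ _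
  | succ i ih =>
    intro m l hma J hJ g hg S hS h0 hJS hk
    have hm := one_le_of_eq_pow ha hma
    have hm' : 1 ≤ Real.sqrt m := Real.one_le_sqrt.2 hm
    have hsqrt := sqrt_eq_of_eq_pow hma
    have hsc := cast_sc_of_eq_pow hma
    have hsc' := cast_sc_of_eq_pow hsqrt
    have hsq : (sc (Real.sqrt m) : ℝ) ^ 2 = sc m := by
      rw [hsc', hsc, ← pow_mul, ← pow_succ]
    have hle : ∀ n : ℕ, 2 * (a : ℝ) ≤ (2 * a) ^ 2 ^ n := fun n =>
      le_self_pow₀ (by linarith) (by positivity)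
    obtain ⟨u, v, w, hw, hwk⟩ := hX.exists_path hT hS ⟨_, h0⟩ hk
    refine le_sum_branchSum_of_forall hT hlen hw hm hg (D := sc m) ha' (h256 (i + 1))
      (by linarith [(sc m).cast_nonneg (α := ℝ)]) (by rw [hsc]; linarith [hle (i + 1)]) hJ
      fun j hj => ?_
    set P : Set W := {p | p ∈ w.support}
    have hcopy : ∑ b, branchSum (spDist T len) (g ∘ incl j) b ≤
        branchSum (spDist T len) g j := by
      rw [branchSum_eq _ g, sum_eq_sum_branchSum]
      exact le_add_of_nonneg_left (Finset.sum_nonneg fun _ _ => hnn _ _)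
    have hS0 : (g ∘ incl j) none ∈ S := by
      rw [Function.comp_apply, incl_none j (sc_pos hm)]
      exact hJS j hj _
    set K : Finset (Fin (sc (Real.sqrt m))) := Finset.univ.filter fun b =>
      ∀ x : Branch i (Real.sqrt m), Disjoint (separators T
        ((g ∘ incl j) (par (i + 1) _ _ (vtx b x))) ((g ∘ incl j) (some (vtx b x)))) P
    by_cases hK : sc (Real.sqrt m) ≤ 2 * K.card
    · left
      have hKne : K.Nonempty := Finset.card_pos.1 (by have := sc_pos hm'; omega)
      have hmem := fun b (hb : b ∈ K) => mem_avoiding_of_branch hm' hS0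
        (fun x => hJS j hj (Sum.inr (vtx b x))) (Finset.mem_filter.1 hb).2
      have h := ih hsqrt hK (hg.comp_incl hm j) (hS.avoiding P ((g ∘ incl j) none))
        (hmem _ hKne.choose_spec).1 (fun b hb => (hmem b hb).2) (hwk _)
      rw [hsq] at h
      calc (sc m : ℝ) * a / 2 ^ (8 + 2 * (i + 1)) = sc m * a / (4 * 2 ^ (8 + 2 * i)) := by
            congr 1
            ring
        _ ≤ _ := h
        _ ≤ ∑ b, branchSum (spDist T len) (g ∘ incl j) b :=
          Finset.sum_le_sum_of_subset_of_nonneg (Finset.subset_univ _)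
            fun b _ _ => branchSum_nonneg hnn _ b
        _ ≤ _ := hcopy
    · right
      by_contra! hcon
      obtain ⟨hlt, hcon⟩ := hcon
      refine hlt.not_ge (le_trans ?_ hcopy)
      have hlarge : ∀ b ∈ Kᶜ, (sc m : ℝ) / 2 ≤ branchSum (spDist T len) (g ∘ incl j) b := by
        intro b hb
        have hb' : ∃ x : Branch i (Real.sqrt m), ¬ Disjoint (separators T
            ((g ∘ incl j) (par (i + 1) _ _ (vtx b x))) ((g ∘ incl j) (some (vtx b x)))) P := by
          by_contra! h
          exact Finset.mem_compl.1 hb (Finset.mem_filter.2 ⟨Finset.mem_univ b, h⟩)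
        obtain ⟨x, hx⟩ := hb'
        obtain ⟨p, hp, hpP⟩ := Set.not_disjoint_iff.1 hx
        by_contra! hsmall
        refine hcon (Sum.inr (vtx b x)) le_rfl (lt_of_le_of_lt ?_ hsmall) p hpP hp
        exact Finset.single_le_sum (f := fun x => spDist T len
          ((g ∘ incl j) (par (i + 1) _ _ (vtx b x))) ((g ∘ incl j) (some (vtx b x))))
          (fun _ _ => hnn _ _) (Finset.mem_univ x)
      have hcard : sc (Real.sqrt m) ≤ 2 * Kᶜ.card := by
        rw [Finset.card_compl, Fintype.card_fin]
        omega
      have hcard' : (a : ℝ) ≤ Kᶜ.card := by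
        have h₁ : (sc (Real.sqrt m) : ℝ) ≤ 2 * Kᶜ.card := by exact_mod_cast hcard
        have h₂ := hle i
        rw [hsc'] at h₁
        linarith
      have h := Finset.card_nsmul_le_sum _ _ _ hlarge
      rw [nsmul_eq_mul] at h
      calc (a : ℝ) * sc m / 2 = a * (sc m / 2) := by ring
        _ ≤ Kᶜ.card * (sc m / 2 : ℝ) := by gcongr
        _ ≤ _ := h
        _ ≤ _ := Finset.sum_le_sum_of_subset_of_nonneg (Finset.subset_univ _)
          fun b _ _ => branchSum_nonneg hnn _ b

theorem card_eq_of_eq_pow {a : ℕ} (i : ℕ) : ∀ {m : ℝ} (_ : m = (2 * (a : ℝ)) ^ 2 ^ i),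
    (Fintype.card (PsiC i m (sc m)) : ℝ) = i * m := by
  induction i with
  | zero =>
    intro m _
    have : IsEmpty (PsiC 0 m (sc m)) := inferInstanceAs (IsEmpty Empty)
    simp
  | succ i ih =>
    intro m hm
    rw [card_succ]
    push_cast
    rw [ih (sqrt_eq_of_eq_pow hm), cast_sc_of_eq_pow hm, sqrt_eq_of_eq_pow hm, hm, pow_succ 2,
      pow_mul]
    ring

end PsiC

/-- **Lemma (inductive lower bound).** Let `k ≥ 1` and let `g` be a non-contractive embedding
of the unit-weighted tree `Ψ_{k,m,√m/2}` into a metric tree `T` of pathwidth at most `k`.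
Then for all `m = (2a)^(2^k)` with `a ∈ ℕ`, the average stretch over the edges is at least
`m^(2^{-k}) / (2^(8+2k) · k)`. -/
theorem lower_bound_inductive_case (k : ℕ) (hk : 1 ≤ k) (a : ℕ) (m : ℝ)
    (hm : m = (2 * (a : ℝ)) ^ (2 ^ k))
    {W : Type} [Fintype W]
    (T : SimpleGraph W) (hT : T.IsTree) (hpw : pathwidthLE T k)
    (len : Sym2 W → ℝ) (hlen : ∀ e, 0 ≤ len e)
    (g : Option (PsiC k m ⌈Real.sqrt m / 2⌉₊) → W)
    (hg : ∀ u v, ((PsiGraph k m ⌈Real.sqrt m / 2⌉₊).dist u v : ℝ) ≤ spDist T len (g u) (g v)) :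
    m ^ ((1 : ℝ) / 2 ^ k) / (2 ^ (8 + 2 * k) * k) ≤
      edgeSum (PsiGraph k m ⌈Real.sqrt m / 2⌉₊) (fun u v => spDist T len (g u) (g v)) /
        numEdges (PsiGraph k m ⌈Real.sqrt m / 2⌉₊) := by
  obtain ⟨k, rfl⟩ := Nat.exists_eq_succ_of_ne_zero (Nat.one_le_iff_ne_zero.1 hk)
  simp only [Nat.succ_eq_add_one] at *
  have hnn := spDist_nonneg (T := T) hlen
  rcases Nat.eq_zero_or_pos a with rfl | ha
  · have h0 : m ^ ((1 : ℝ) / 2 ^ (k + 1)) = 0 := by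
      rw [show m = 0 by simp [hm], Real.zero_rpow (by positivity)]
    rw [h0, zero_div]
    refine div_nonneg (div_nonneg ?_ two_pos.le) (div_nonneg ?_ two_pos.le) <;>
    refine Finset.sum_nonneg fun u _ => Finset.sum_nonneg fun v _ => ?_
    · split_ifs
      exacts [hnn _ _, le_rfl]
    · split_ifs
      exacts [zero_le_one, le_rfl]
  have ha' : (0 : ℝ) < a := Nat.cast_pos.2 ha
  have hm1 := PsiC.one_le_of_eq_pow ha hm
  have hsc := PsiC.cast_sc_of_eq_pow hm
  have hsqrt := PsiC.sqrt_eq_of_eq_pow hm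
  have hsq : (sc m : ℝ) ^ 2 = m := by rw [hsc, hm, pow_succ 2, pow_mul]
  have hceil : (⌈Real.sqrt m / 2⌉₊ : ℝ) = Real.sqrt m / 2 := by
    have h : Real.sqrt m / 2 = ((2 ^ (2 ^ k - 1) * a ^ 2 ^ k : ℕ) : ℝ) := by
      rw [hsqrt, mul_pow, ← Nat.sub_add_cancel (Nat.one_le_two_pow (n := k)), pow_succ 2]
      push_cast
      ring
    rw [h, Nat.ceil_natCast]
  obtain ⟨t, X, hX, hXk⟩ := hpw
  have hsum := PsiC.le_sum_branchSum hT hlen hX ha k hm (J := Finset.univ)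
    (by
      rw [Finset.card_univ, Fintype.card_fin, ← Nat.cast_le (α := ℝ)]
      push_cast
      rw [hceil, hsc, hsqrt]
      linarith)
    (PsiC.NonContractive.of_dist_le hm1 hg) (S := Set.univ) (fun _ _ _ _ => Set.subset_univ _)
    (Set.mem_univ _) (fun _ _ _ => Set.mem_univ _)
    (fun s => by simpa using hXk s)
  rw [← PsiC.sum_eq_sum_branchSum, hsq] at hsum
  rw [PsiC.edgeSum_eq hm1 _ fun u v => spDist_comm hT.connected hlen _ _,
    PsiC.numEdges_eq hm1, PsiC.card_succ]
  push_cast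
  rw [PsiC.card_eq_of_eq_pow k hsqrt, hceil, hsc, ← hsqrt]
  have hroot : m ^ ((1 : ℝ) / 2 ^ (k + 1)) = 2 * a := by
    rw [hm, one_div, ← Nat.cast_ofNat (R := ℝ), ← Nat.cast_pow]
    exact Real.pow_rpow_inv_natCast (by positivity) (by positivity)
  have hs0 : 0 < Real.sqrt m := Real.sqrt_pos.2 (by linarith)
  rw [hroot, le_div_iff₀ (by positivity)]
  refine le_of_eq_of_le ?_ hsum
  have hss : Real.sqrt m * Real.sqrt m = m := Real.mul_self_sqrt (by linarith)
  rw [← hss, show 8 + 2 * (k + 1) = 8 + 2 * k + 2 by ring, pow_add _ _ 2,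
    Real.sqrt_mul_self hs0.le]
  field_simp
  ring
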